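/- Let E_L and E_U be measurable spaces and, for each (l, u) ∈ E_L × E_U, let μ₀^{l,u} and μ₁^{l,u} be atomless Borel probability measures on ℝ. (i) If there is a function γ : ℝ × E_L → ℝ such that γ(y, l) = Q_{μ₁^{l,u}}(F_{μ₀^{l,u}}(y)) for all y ∈ ℝ and all (l, u) (i.e., the quantile–quantile transform does not depend on u), then for each l the map y ↦ γ(y, l) is nondecreasing and the pushforward of μ₀^{l,u} under γ(·, l) equals μ₁^{l,u} for every (l, u). (ii) Conversely, if γ : ℝ × E_L → ℝ is nondecreasing in its first argument and the pushforward of μ₀^{l,u} under γ(·, l) equals μ₁^{l,u} for every (l, u), then for each (l, u) one has γ(y, l) = Q_{μ₁^{l,u}}(F_{μ₀^{l,u}}(y)) for μ₀^{l,u}-almost every y; in particular, for fixed l the quantile–quantile transforms associated with different values of u agree μ₀^{l,u}-almost everywhere. -/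

import Mathlib

open MeasureTheory Set

/-- The cumulative distribution function of a Borel measure on `ℝ`: `F_μ(x) = μ((-∞, x])`. -/
noncomputable def distFn (μ : Measure ℝ) (x : ℝ) : ℝ := (μ (Set.Iic x)).toReal

/-- The quantile function of a Borel measure on `ℝ`: `Q_μ(p) = inf {x | F_μ(x) ≥ p}`
(the value taken outside `p ∈ (0,1)` is a junk value). -/
noncomputable def quantileFn (μ : Measure ℝ) (p : ℝ) : ℝ := sInf {x : ℝ | p ≤ distFn μ x}

lemma distFn_eq_cdf (μ : Measure ℝ) [IsProbabilityMeasure μ] :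
    distFn μ = ProbabilityTheory.cdf μ := by
  ext x
  rw [ProbabilityTheory.cdf_eq_real]
  rfl

lemma monotone_distFn (μ : Measure ℝ) [IsProbabilityMeasure μ] : Monotone (distFn μ) := by
  rw [distFn_eq_cdf]
  exact ProbabilityTheory.monotone_cdf μ

lemma distFn_nonneg (μ : Measure ℝ) (x : ℝ) : 0 ≤ distFn μ x :=
  ENNReal.toReal_nonneg

lemma distFn_le_one (μ : Measure ℝ) [IsProbabilityMeasure μ] (x : ℝ) : distFn μ x ≤ 1 := by
  rw [distFn_eq_cdf]
  exact ProbabilityTheory.cdf_le_one μ x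

lemma exists_distFn_lt (μ : Measure ℝ) [IsProbabilityMeasure μ] {p : ℝ} (hp : 0 < p) :
    ∃ x, distFn μ x < p := by
  rw [distFn_eq_cdf]
  exact ((ProbabilityTheory.tendsto_cdf_atBot μ).eventually_lt_const hp).exists

lemma exists_lt_distFn (μ : Measure ℝ) [IsProbabilityMeasure μ] {p : ℝ} (hp : p < 1) :
    ∃ x, p < distFn μ x := by
  rw [distFn_eq_cdf]
  exact ((ProbabilityTheory.tendsto_cdf_atTop μ).eventually_const_lt hp).exists

lemma ofReal_distFn (μ : Measure ℝ) [IsProbabilityMeasure μ] (x : ℝ) :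
    ENNReal.ofReal (distFn μ x) = μ (Iic x) :=
  ENNReal.ofReal_toReal (measure_ne_top _ _)

/-- The distribution function of an atomless probability measure is continuous. -/
lemma continuous_distFn (μ : Measure ℝ) [IsProbabilityMeasure μ] (ha : ∀ x : ℝ, μ {x} = 0) :
    Continuous (distFn μ) := by
  rw [distFn_eq_cdf]
  refine continuous_iff_continuousAt.2 fun x => ?_
  have hmono := ProbabilityTheory.monotone_cdf μ
  rw [hmono.continuousAt_iff_leftLim_eq_rightLim, StieltjesFunction.rightLim_eq]
  have h := ha x
  rw [← ProbabilityTheory.measure_cdf μ, StieltjesFunction.measure_singleton,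
    ENNReal.ofReal_eq_zero] at h
  exact le_antisymm (hmono.leftLim_le le_rfl) (by linarith)

lemma bddBelow_le_distFn (μ : Measure ℝ) [IsProbabilityMeasure μ] {p : ℝ} (hp : 0 < p) :
    BddBelow {x : ℝ | p ≤ distFn μ x} := by
  obtain ⟨b, hb⟩ := exists_distFn_lt μ hp
  exact ⟨b, fun x hx => ((monotone_distFn μ).reflect_lt (hb.trans_le hx)).le⟩

/-- The Galois connection between the quantile function and the distribution function. -/
lemma quantileFn_le_iff (μ : Measure ℝ) [IsProbabilityMeasure μ] (ha : ∀ x : ℝ, μ {x} = 0)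
    {p : ℝ} (hp : p ∈ Ioo (0 : ℝ) 1) (x : ℝ) : quantileFn μ p ≤ x ↔ p ≤ distFn μ x := by
  have hbdd := bddBelow_le_distFn μ hp.1
  refine ⟨fun h => ?_, fun h => csInf_le hbdd h⟩
  obtain ⟨c, hc⟩ := exists_lt_distFn μ hp.2
  have hclosed : IsClosed {x : ℝ | p ≤ distFn μ x} :=
    isClosed_le continuous_const (continuous_distFn μ ha)
  have hmem : p ≤ distFn μ (quantileFn μ p) := hclosed.csInf_mem ⟨c, hc.le⟩ hbdd
  exact hmem.trans (monotone_distFn μ h)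

lemma monotoneOn_quantileFn (μ : Measure ℝ) [IsProbabilityMeasure μ] :
    MonotoneOn (quantileFn μ) (Ioo 0 1) := by
  intro p hp q hq hpq
  obtain ⟨c, hc⟩ := exists_lt_distFn μ hq.2
  exact csInf_le_csInf (bddBelow_le_distFn μ hp.1) ⟨c, hc.le⟩ fun x hx => hpq.trans hx

/-- The probability integral transform: `distFn μ` is uniformly distributed under `μ`. -/
lemma measure_distFn_le (μ : Measure ℝ) [IsProbabilityMeasure μ] (ha : ∀ x : ℝ, μ {x} = 0)
    {t : ℝ} (h0 : 0 ≤ t) (h1 : t ≤ 1) : μ {y | distFn μ y ≤ t} = ENNReal.ofReal t := by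
  rcases h1.eq_or_lt with rfl | h1
  · simp [distFn_le_one]
  have hcont := continuous_distFn μ ha
  have hmono := monotone_distFn μ
  obtain ⟨c, hc⟩ := exists_lt_distFn μ h1
  have hclosed : IsClosed {y | distFn μ y ≤ t} := isClosed_le hcont continuous_const
  have hbdd : BddAbove {y | distFn μ y ≤ t} :=
    ⟨c, fun y hy => (hmono.reflect_lt (lt_of_le_of_lt hy hc)).le⟩
  rcases {y | distFn μ y ≤ t}.eq_empty_or_nonempty with he | hne
  · have ht : t = 0 := by
      by_contra ht
      obtain ⟨b, hb⟩ := exists_distFn_lt μ (h0.lt_of_ne' ht)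
      exact (he ▸ hb.le : b ∈ (∅ : Set ℝ))
    rw [he, ht, measure_empty, ENNReal.ofReal_zero]
  · set s := sSup {y | distFn μ y ≤ t}
    have hmem : distFn μ s ≤ t := hclosed.csSup_mem hne hbdd
    have hset : {y | distFn μ y ≤ t} = Iic s :=
      Subset.antisymm (fun y hy => le_csSup hbdd hy) fun y hy => (hmono hy).trans hmem
    obtain ⟨x, hx⟩ : t ∈ range (distFn μ) :=
      mem_range_of_exists_le_of_exists_ge hcont hne ⟨c, hc.le⟩
    have hst : distFn μ s = t := hmem.antisymm (hx ▸ hmono (le_csSup hbdd hx.le))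
    rw [hset, ← ofReal_distFn, hst]

lemma ae_distFn_mem_Ioo (μ : Measure ℝ) [IsProbabilityMeasure μ] (ha : ∀ x : ℝ, μ {x} = 0) :
    ∀ᵐ y ∂μ, distFn μ y ∈ Ioo (0 : ℝ) 1 := by
  have hpos : ∀ᵐ y ∂μ, 0 < distFn μ y := by
    have h := measure_distFn_le μ ha le_rfl zero_le_one
    simpa [ae_iff] using h
  have hlt : ∀ᵐ y ∂μ, distFn μ y < 1 := by
    have hmeas : MeasurableSet {y | distFn μ y < 1} :=
      measurableSet_lt (monotone_distFn μ).measurable measurable_const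
    refine (mem_ae_iff_prob_eq_one hmeas).2 (prob_le_one.antisymm ?_)
    refine le_of_forall_lt_imp_le_of_dense fun a ha1 => ?_
    have hatop : a ≠ ⊤ := ha1.ne_top
    have ha1' : a.toReal < 1 := by
      simpa using ENNReal.toReal_strict_mono ENNReal.one_ne_top ha1
    rw [← ENNReal.ofReal_toReal hatop,
      ← measure_distFn_le μ ha ENNReal.toReal_nonneg ha1'.le]
    exact measure_mono fun y hy => lt_of_le_of_lt hy ha1'
  filter_upwards [hpos, hlt] with y h0 h1 using ⟨h0, h1⟩

/-- The quantile-quantile transform is monotone where it is genuinely defined. -/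
lemma monotoneOn_quantileFn_distFn (μ ν : Measure ℝ) [IsProbabilityMeasure μ]
    [IsProbabilityMeasure ν] :
    MonotoneOn (fun y => quantileFn ν (distFn μ y)) {y | 0 < distFn μ y ∧ distFn μ y < 1} :=
  fun _ hx _ hy hxy => monotoneOn_quantileFn ν hx hy (monotone_distFn μ hxy)

lemma aemeasurable_quantileFn_distFn (μ ν : Measure ℝ) [IsProbabilityMeasure μ]
    [IsProbabilityMeasure ν] (ha : ∀ x : ℝ, μ {x} = 0) :
    AEMeasurable (fun y => quantileFn ν (distFn μ y)) μ := by
  have hmeas : MeasurableSet {y | 0 < distFn μ y ∧ distFn μ y < 1} :=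
    (monotone_distFn μ).measurable measurableSet_Ioo
  have h := aemeasurable_restrict_of_monotoneOn (μ := μ) hmeas (monotoneOn_quantileFn_distFn μ ν)
  have hres : μ.restrict {y | 0 < distFn μ y ∧ distFn μ y < 1} = μ :=
    Measure.restrict_eq_self_of_ae_mem (ae_distFn_mem_Ioo μ ha)
  rwa [hres] at h

/-- The quantile-quantile transform pushes `μ` forward to `ν`. -/
lemma map_quantileFn_distFn (μ ν : Measure ℝ) [IsProbabilityMeasure μ] [IsProbabilityMeasure ν]
    (hμ : ∀ x : ℝ, μ {x} = 0) (hν : ∀ x : ℝ, ν {x} = 0) :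
    μ.map (fun y => quantileFn ν (distFn μ y)) = ν := by
  have hm := aemeasurable_quantileFn_distFn μ ν hμ
  have := Measure.isProbabilityMeasure_map hm
  refine Measure.ext_of_Iic _ _ fun x => ?_
  rw [Measure.map_apply_of_aemeasurable hm measurableSet_Iic, ← ofReal_distFn ν x,
    ← measure_distFn_le μ hμ (distFn_nonneg ν x) (distFn_le_one ν x)]
  refine measure_congr ?_
  filter_upwards [ae_distFn_mem_Ioo μ hμ] with y hy
  exact propext (quantileFn_le_iff ν hν hy x)

/-- Two real functions with the same law, one of which dominates the other, agree almost
everywhere. -/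
lemma ae_eq_of_ae_le_of_map_eq {Ω : Type*} [MeasurableSpace Ω] {μ : Measure Ω}
    [IsFiniteMeasure μ] {f g : Ω → ℝ} (hf : AEMeasurable f μ) (hg : AEMeasurable g μ)
    (hle : f ≤ᵐ[μ] g) (hmap : μ.map f = μ.map g) : f =ᵐ[μ] g := by
  have key : ∀ q : ℚ, g ⁻¹' Iic (q : ℝ) =ᵐ[μ] f ⁻¹' Iic (q : ℝ) := fun q => by
    refine ae_eq_of_ae_subset_of_measure_ge ?_ ?_ (hg.nullMeasurableSet_preimage measurableSet_Iic)
      (measure_ne_top _ _)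
    · filter_upwards [hle] with y hy h using hy.trans h
    · rw [← Measure.map_apply_of_aemeasurable hf measurableSet_Iic, hmap,
        Measure.map_apply_of_aemeasurable hg measurableSet_Iic]
  filter_upwards [hle, ae_all_iff.2 key] with y hy hq
  refine hy.antisymm (le_of_not_gt fun hlt => ?_)
  obtain ⟨q, hfq, hqg⟩ := exists_rat_btwn hlt
  exact hqg.not_ge ((hq q).mpr hfq.le)

/-- A nondecreasing map pushing `μ` forward to `ν` is the quantile-quantile transform. -/
lemma ae_eq_quantileFn_distFn (μ ν : Measure ℝ) [IsProbabilityMeasure μ] [IsProbabilityMeasure ν]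
    (hμ : ∀ x : ℝ, μ {x} = 0) (hν : ∀ x : ℝ, ν {x} = 0) {g : ℝ → ℝ} (hg : Monotone g)
    (hmap : μ.map g = ν) : ∀ᵐ y ∂μ, g y = quantileFn ν (distFn μ y) := by
  have hle : (fun y => quantileFn ν (distFn μ y)) ≤ᵐ[μ] g := by
    filter_upwards [ae_distFn_mem_Ioo μ hμ] with y hy
    rw [quantileFn_le_iff ν hν hy]
    refine ENNReal.toReal_mono (measure_ne_top _ _) ?_
    rw [← hmap, Measure.map_apply hg.measurable measurableSet_Iic]
    exact measure_mono fun z hz => hg hz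
  filter_upwards [ae_eq_of_ae_le_of_map_eq (aemeasurable_quantileFn_distFn μ ν hμ)
    hg.measurable.aemeasurable hle ((map_quantileFn_distFn μ ν hμ hν).trans hmap.symm)] with y hy
  exact hy.symm

/-- Characterization of the distributional bridge assumption via invariance of the conditional
quantile-quantile transform with respect to the latent variable `u`.
(i) If `γ(y, l) = Q_{μ₁^{l,u}}(F_{μ₀^{l,u}}(y))` for all `y` and all `(l, u)` (invariance in
`u`), then `γ(·, l)` is nondecreasing (on the region where the cdf lies in `(0,1)`, i.e. where
the quantile-quantile transform is genuinely defined) and pushes `μ₀^{l,u}` forward to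
`μ₁^{l,u}` for every `(l, u)`.
(ii) Conversely, if `γ` is nondecreasing in its first argument and pushes `μ₀^{l,u}` forward
to `μ₁^{l,u}` for every `(l, u)`, then `γ(y, l) = Q_{μ₁^{l,u}}(F_{μ₀^{l,u}}(y))` for
`μ₀^{l,u}`-almost every `y`, for each `(l, u)`; in particular, for fixed `l` the
quantile-quantile transforms associated with different values of `u` agree almost everywhere. -/
theorem quantile_quantile_transform_invariance
    {E_L E_U : Type*} [MeasurableSpace E_L] [MeasurableSpace E_U]
    (μ₀ μ₁ : E_L → E_U → Measure ℝ)
    (h₀p : ∀ l u, IsProbabilityMeasure (μ₀ l u)) (h₁p : ∀ l u, IsProbabilityMeasure (μ₁ l u))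
    (h₀a : ∀ l u, ∀ x : ℝ, μ₀ l u {x} = 0) (h₁a : ∀ l u, ∀ x : ℝ, μ₁ l u {x} = 0) :
    (∀ γ : ℝ → E_L → ℝ,
      (∀ (y : ℝ) (l : E_L) (u : E_U), γ y l = quantileFn (μ₁ l u) (distFn (μ₀ l u) y)) →
      (∀ l u, MonotoneOn (fun y => γ y l)
          {y : ℝ | 0 < distFn (μ₀ l u) y ∧ distFn (μ₀ l u) y < 1}) ∧
      (∀ l u, Measure.map (fun y => γ y l) (μ₀ l u) = μ₁ l u))
    ∧
    (∀ γ : ℝ → E_L → ℝ,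
      (∀ l : E_L, Monotone (fun y => γ y l)) →
      (∀ l u, Measure.map (fun y => γ y l) (μ₀ l u) = μ₁ l u) →
      ∀ l u, ∀ᵐ y ∂(μ₀ l u), γ y l = quantileFn (μ₁ l u) (distFn (μ₀ l u) y)) := by
  refine ⟨fun γ hγ => ⟨fun l u => ?_, fun l u => ?_⟩, fun γ hmono hmap l u => ?_⟩
  · have := h₀p l u
    have := h₁p l u
    simpa only [hγ _ l u] using monotoneOn_quantileFn_distFn (μ₀ l u) (μ₁ l u)
  · have := h₀p l u
    have := h₁p l u
    simpa only [hγ _ l u] using map_quantileFn_distFn (μ₀ l u) (μ₁ l u) (h₀a l u) (h₁a l u)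
  · have := h₀p l u
    have := h₁p l u
    exact ae_eq_quantileFn_distFn (μ₀ l u) (μ₁ l u) (h₀a l u) (h₁a l u) (hmono l) (hmap l u)
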